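/- Let n ≥ 1, 0 < p ≤ 1, α > −1 and m ∈ ℕ₀ with p(m+n+1) > n + 1 + α. There exists a constant C > 0 such that for every f ∈ A_α^p(ℝ^{n+1}_+): ∫_{ℝ^{n+1}_+} ( ∫_{ℝ^{n+1}_+} |f(w)| |Q_m(z,w)| s^m dy ds )^p t^α dx dt ≤ C ‖f‖_{A_α^p}^p, where z = (x,t) and w = (y,s). -/

import Mathlib

open MeasureTheory Real Set
open scoped ENNReal

noncomputable section

abbrev Euc (N : ℕ) : Type := EuclideanSpace ℝ (Fin N)

/-- The point `(x, t) ∈ ℝ^{n+1}`. -/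
def pt {n : ℕ} (x : Euc n) (t : ℝ) : Euc (n + 1) :=
  (EuclideanSpace.equiv (Fin (n + 1)) ℝ).symm (Fin.snoc (fun i => x i) t)

/-- horizontal part of a point of ℝ^{n+1} -/
def xp {n : ℕ} (z : Euc (n + 1)) : Euc n :=
  (EuclideanSpace.equiv (Fin n) ℝ).symm (fun i => z i.castSucc)

/-- vertical part of a point of ℝ^{n+1} -/
def tp {n : ℕ} (z : Euc (n + 1)) : ℝ := z (Fin.last n)

/-- The upper half space ℝ^{n+1}_+. -/
def upperHS (n : ℕ) : Set (Euc (n + 1)) := {z | 0 < tp z}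

/-- |z - w̄| where z = (x,t), w̄ = (y, -s): Euclidean distance -/
def dB {n : ℕ} (x : Euc n) (t : ℝ) (y : Euc n) (s : ℝ) : ℝ :=
  dist (pt x t) (pt y (-s))

/-- the measure t^λ dx dt on ℝ^n × (0,∞), identified with ℝ^{n+1}_+ -/
def mLam (n : ℕ) (l : ℝ) : Measure (Euc n × ℝ) :=
  ((volume : Measure (Euc n)).prod ((volume : Measure ℝ).restrict (Ioi 0))).withDensity
    (fun zt => ENNReal.ofReal (zt.2 ^ l))

/-- second derivative of `f` at `z` along direction `v` -/
def d2 {V : Type*} [NormedAddCommGroup V] [NormedSpace ℝ V] (f : V → ℝ) (z v : V) : ℝ :=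
  iteratedFDeriv ℝ 2 f z ![v, v]

/-- `f` is harmonic on a subset of ℝ^N : twice continuously differentiable with
vanishing Laplacian. -/
def HarmonicOnE {N : ℕ} (f : Euc N → ℝ) (s : Set (Euc N)) : Prop :=
  ContDiffOn ℝ 2 f s ∧ ∀ z ∈ s, ∑ i, d2 f z (EuclideanSpace.single i 1) = 0

/-- `f` is harmonic on (ℝ^{n+1}_+)^m, viewed as an open subset of ℝ^{m(n+1)}. -/
def HarmonicOnM {n m : ℕ} (f : (Fin m → Euc (n + 1)) → ℝ) : Prop :=
  ContDiffOn ℝ 2 f {z | ∀ j, z j ∈ upperHS n} ∧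
  ∀ z ∈ {z : Fin m → Euc (n + 1) | ∀ j, z j ∈ upperHS n},
    ∑ j, ∑ i, d2 f z (Function.update (0 : Fin m → Euc (n + 1)) j (EuclideanSpace.single i 1)) = 0

/-- `f` is harmonic in each variable separately on (ℝ^{n+1}_+)^m -/
def HarmonicSep {n m : ℕ} (f : (Fin m → Euc (n + 1)) → ℝ) : Prop :=
  ∀ (j : Fin m) (z : Fin m → Euc (n + 1)), (∀ k, z k ∈ upperHS n) →
    HarmonicOnE (fun w => f (Function.update z j w)) (upperHS n)

/-- the closed cube centered at (y,s) with side length s -/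
def Qcube {n : ℕ} (y : Euc n) (s : ℝ) : Set (Euc (n + 1)) :=
  {z | (∀ i : Fin n, |z (Fin.castSucc i) - y i| ≤ s / 2) ∧ |tp z - s| ≤ s / 2}

/-- the A^p_λ (quasi)-norm, raised to the power p -/
def normAp (n : ℕ) (f : Euc (n + 1) → ℝ) (p l : ℝ) : ℝ≥0∞ :=
  ∫⁻ zt : Euc n × ℝ, ENNReal.ofReal (|f (pt zt.1 zt.2)| ^ p) ∂(mLam n l)

/-- membership in the harmonic Bergman space A^p_λ -/
def memAp (n : ℕ) (f : Euc (n + 1) → ℝ) (p l : ℝ) : Prop :=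
  HarmonicOnE f (upperHS n) ∧ normAp n f p l < ⊤


/-- Lebesgue measure dy ds on ℝ^n × (0,∞) -/
def baseM (n : ℕ) : Measure (Euc n × ℝ) :=
  (volume : Measure (Euc n)).prod ((volume : Measure ℝ).restrict (Ioi 0))

/-- the standard normalizing constant of the Poisson kernel for ℝ^{n+1}_+ -/
def cP (n : ℕ) : ℝ := Real.Gamma (((n : ℝ) + 1) / 2) / Real.pi ^ (((n : ℝ) + 1) / 2)

/-- the Poisson kernel P(x,t) = c_n t (|x|² + t²)^{-(n+1)/2} for ℝ^{n+1}_+ -/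
def Pker (n : ℕ) (x : Euc n) (t : ℝ) : ℝ :=
  cP n * t / (‖x‖ ^ 2 + t ^ 2) ^ (((n : ℝ) + 1) / 2)

/-- the harmonic Bergman kernel Q_m(z,w), z = (x,t), w = (y,s) -/
def Qker (n m : ℕ) (x : Euc n) (t : ℝ) (y : Euc n) (s : ℝ) : ℝ :=
  ((-2 : ℝ) ^ (m + 1) / (Nat.factorial m : ℝ)) *
    iteratedDeriv (m + 1) (fun u => Pker n (x - y) u) (t + s)

open Metric Filter Topology

lemma hasDerivAt_max_zero_cube (v : ℝ) :
    HasDerivAt (fun v : ℝ => (max v 0) ^ 3) (3 * (max v 0) ^ 2) v := by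
  rcases lt_trichotomy v 0 with h | rfl | h
  · have h1 : (fun v : ℝ => (max v 0) ^ 3) =ᶠ[𝓝 v] fun _ => 0 := by
      filter_upwards [eventually_lt_nhds h] with u hu
      simp [max_eq_right hu.le]
    rw [max_eq_right h.le]
    simpa using (hasDerivAt_const v (0 : ℝ)).congr_of_eventuallyEq h1
  · have h1 : HasFDerivAt (fun v : ℝ => (max v 0) ^ 3) (0 : ℝ →L[ℝ] ℝ) 0 := by
      refine Asymptotics.IsBigO.hasFDerivAt (n := 3) ?_ (by norm_num)
      refine Asymptotics.IsBigO.of_bound 1 (Eventually.of_forall fun u => ?_)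
      simp only [norm_pow, sub_zero, Real.norm_eq_abs, abs_abs, one_mul]
      refine pow_le_pow_left₀ (abs_nonneg _) ?_ 3
      rcases le_total u 0 with hu | hu
      · rw [max_eq_right hu, abs_zero]
        exact abs_nonneg u
      · simp [max_eq_left hu]
    simpa using h1.hasDerivAt
  · have h1 : (fun v : ℝ => (max v 0) ^ 3) =ᶠ[𝓝 v] fun v => v ^ 3 := by
      filter_upwards [eventually_gt_nhds h] with u hu
      simp [max_eq_left hu.le]
    rw [max_eq_left h.le]
    simpa using (hasDerivAt_pow 3 v).congr_of_eventuallyEq h1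

/-- A radial `C¹` bump function supported in the closed unit ball. -/
def cubeBump (N : ℕ) (y : Euc N) : ℝ := (max (1 - ‖y‖ ^ 2) 0) ^ 3

/-- The radial weight for which `∇ (cubeBump N) y = -6 • sqBump N y • y`. -/
def sqBump (N : ℕ) (y : Euc N) : ℝ := (max (1 - ‖y‖ ^ 2) 0) ^ 2

lemma hasFDerivAt_cubeBump {N : ℕ} (y : Euc N) :
    HasFDerivAt (cubeBump N) ((-6 * sqBump N y) • innerSL ℝ y) y := by
  have h1 : HasFDerivAt (fun y : Euc N => 1 - ‖y‖ ^ 2) (-(2 • innerSL ℝ y)) y :=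
    (hasStrictFDerivAt_norm_sq y).hasFDerivAt.const_sub 1
  have h2 := (hasDerivAt_max_zero_cube (1 - ‖y‖ ^ 2)).comp_hasFDerivAt y h1
  convert! h2 using 1
  ext v
  simp [sqBump]
  ring

lemma continuous_sqBump (N : ℕ) : Continuous (sqBump N) := by
  unfold sqBump; fun_prop

lemma continuous_cubeBump (N : ℕ) : Continuous (cubeBump N) := by
  unfold cubeBump; fun_prop

lemma sqBump_nonneg {N : ℕ} (y : Euc N) : 0 ≤ sqBump N y := by
  unfold sqBump; positivity

lemma sqBump_le_one {N : ℕ} (y : Euc N) : sqBump N y ≤ 1 := by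
  unfold sqBump
  exact pow_le_one₀ (le_max_right _ _) (max_le (by nlinarith [sq_nonneg ‖y‖]) zero_le_one)

lemma max_one_sub_norm_sq_eq_zero {N : ℕ} {y : Euc N} (hy : y ∉ ball (0 : Euc N) 1) :
    max (1 - ‖y‖ ^ 2) 0 = 0 := by
  have : 1 ≤ ‖y‖ := by simpa using hy
  exact max_eq_right (by nlinarith)

lemma sqBump_eq_zero {N : ℕ} {y : Euc N} (hy : y ∉ ball (0 : Euc N) 1) : sqBump N y = 0 := by
  simp [sqBump, max_one_sub_norm_sq_eq_zero hy]

lemma cubeBump_eq_zero {N : ℕ} {y : Euc N} (hy : y ∉ ball (0 : Euc N) 1) :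
    cubeBump N y = 0 := by
  simp [cubeBump, max_one_sub_norm_sq_eq_zero hy]

lemma hasCompactSupport_of_eq_zero_off_ball {N : ℕ} {h : Euc N → ℝ}
    (hh : ∀ y, y ∉ ball (0 : Euc N) 1 → h y = 0) : HasCompactSupport h :=
  HasCompactSupport.intro (isCompact_closedBall (0 : Euc N) 1)
    fun y hy => hh y fun h' => hy (ball_subset_closedBall h')

lemma hasCompactSupport_sqBump (N : ℕ) : HasCompactSupport (sqBump N) :=
  hasCompactSupport_of_eq_zero_off_ball fun _ => sqBump_eq_zero

lemma hasCompactSupport_cubeBump (N : ℕ) : HasCompactSupport (cubeBump N) :=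
  hasCompactSupport_of_eq_zero_off_ball fun _ => cubeBump_eq_zero

lemma integral_sqBump_pos (N : ℕ) : 0 < ∫ y, sqBump N y := by
  refine (continuous_sqBump N).integral_pos_of_hasCompactSupport_nonneg_nonzero
    (hasCompactSupport_sqBump N) sqBump_nonneg (x := 0) ?_
  simp [sqBump]

/-- The radial derivative of a function harmonic in a ball is orthogonal to radial weights. -/
lemma integral_fderiv_mul_sqBump_eq_zero {N : ℕ} {g : Euc N → ℝ} (hg : ContDiff ℝ 2 g)
    {a : Euc N} {R r : ℝ} (hr0 : 0 ≤ r) (hrR : r ≤ R) (hR : 0 < R)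
    (hΔ : ∀ z ∈ ball a R, ∑ i, d2 g z (EuclideanSpace.single i 1) = 0) :
    ∫ y, fderiv ℝ g (a + r • y) y * sqBump N y = 0 := by
  have hg1 : ContDiff ℝ 1 (fderiv ℝ g) := hg.fderiv_right (by norm_num)
  let e : Fin N → Euc N := fun i => EuclideanSpace.single i 1
  let G : Fin N → Euc N → ℝ := fun i y => fderiv ℝ g (a + r • y) (e i)
  have hG : ∀ i y, HasFDerivAt (G i)
      (r • ((fderiv ℝ (fderiv ℝ g) (a + r • y)).flip (e i))) y := by
    intro i y
    have h1 : HasFDerivAt (fun y : Euc N => a + r • y) (r • ContinuousLinearMap.id ℝ (Euc N)) y :=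
      ((hasFDerivAt_id y).const_smul r).const_add a
    have h2 := ((hg1.differentiable one_ne_zero) (a + r • y)).hasFDerivAt.comp y h1
    have h3 := h2.clm_apply (hasFDerivAt_const (e i) y)
    convert! h3 using 1
    ext v
    simp
  have hGc : ∀ i, Continuous (G i) := fun i =>
    continuous_iff_continuousAt.2 fun y => (hG i y).continuousAt
  have hcont2 : Continuous (fderiv ℝ (fderiv ℝ g)) := hg1.continuous_fderiv one_ne_zero
  have hibp1 : ∀ i, Integrable (fun y => G i y * fderiv ℝ (cubeBump N) y (e i)) := by
    intro i
    simp_rw [fun y => (hasFDerivAt_cubeBump (N := N) y).fderiv]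
    refine Continuous.integrable_of_hasCompactSupport ?_ ?_
    · have := continuous_sqBump N
      have := hGc i
      simp only [_root_.smul_apply, innerSL_apply_apply]
      fun_prop
    · refine hasCompactSupport_of_eq_zero_off_ball fun y hy => ?_
      simp [sqBump_eq_zero hy]
  have hibp2 : ∀ i, Integrable (fun y => fderiv ℝ (G i) y (e i) * cubeBump N y) := by
    intro i
    refine Continuous.integrable_of_hasCompactSupport ?_
      ((hasCompactSupport_cubeBump N).mul_left)
    refine Continuous.mul ?_ (continuous_cubeBump N)
    simp_rw [fun y => (hG i y).fderiv]
    simp only [_root_.smul_apply, ContinuousLinearMap.flip_apply]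
    fun_prop
  have hparts : ∀ i, ∫ y, G i y * fderiv ℝ (cubeBump N) y (e i) =
      - ∫ y, fderiv ℝ (G i) y (e i) * cubeBump N y := fun i =>
    integral_mul_fderiv_eq_neg_fderiv_mul_of_integrable (hibp2 i) (hibp1 i)
      (((hGc i).mul (continuous_cubeBump N)).integrable_of_hasCompactSupport
        (hasCompactSupport_cubeBump N).mul_left)
      (fun y _ => (hG i y).differentiableAt)
      (fun y _ => (hasFDerivAt_cubeBump y).differentiableAt)
  have hpt : ∀ y, fderiv ℝ g (a + r • y) y * sqBump N y =
      (-1 / 6) * ∑ i, G i y * fderiv ℝ (cubeBump N) y (e i) := by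
    intro y
    have hy : y = ∑ i, y i • e i := by
      have := (EuclideanSpace.basisFun (Fin N) ℝ).sum_repr y
      simpa [e] using this.symm
    have h1 : fderiv ℝ g (a + r • y) y = ∑ i, y i * G i y := by
      have h2 := congrArg (fderiv ℝ g (a + r • y)) hy
      rw [map_sum] at h2
      simpa [G] using h2
    rw [h1, Finset.sum_mul, Finset.mul_sum]
    refine Finset.sum_congr rfl fun i _ => ?_
    rw [(hasFDerivAt_cubeBump y).fderiv]
    simp [e, EuclideanSpace.inner_single_right]
    ring
  simp_rw [hpt]
  rw [integral_const_mul, integral_finsetSum _ fun i _ => hibp1 i]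
  simp_rw [hparts]
  rw [Finset.sum_neg_distrib, ← integral_finsetSum _ fun i _ => hibp2 i]
  have hz : ∀ y, ∑ i, fderiv ℝ (G i) y (e i) * cubeBump N y = 0 := by
    intro y
    by_cases hy : y ∈ ball (0 : Euc N) 1
    · rw [← Finset.sum_mul]
      have hmem : a + r • y ∈ ball a R := by
        have : ‖y‖ < 1 := by simpa using hy
        rw [mem_ball, dist_eq_norm, add_sub_cancel_left, norm_smul, Real.norm_eq_abs,
          abs_of_nonneg hr0]
        rcases hr0.eq_or_lt with h | h
        · simpa [← h] using hR
        · nlinarith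
      have h2 := hΔ _ hmem
      simp only [d2, iteratedFDeriv_two_apply, Matrix.cons_val_zero, Matrix.cons_val_one] at h2
      simp_rw [fun i => (hG i y).fderiv]
      simp only [_root_.smul_apply, ContinuousLinearMap.flip_apply, smul_eq_mul]
      rw [← Finset.mul_sum]
      simp only [e]
      rw [h2]
      simp
    · simp [cubeBump_eq_zero hy]
  simp [hz]

/-- Weighted mean value property of globally `C²` functions that are harmonic in a ball. -/
lemma integral_mul_sqBump_eq {N : ℕ} {g : Euc N → ℝ} (hg : ContDiff ℝ 2 g)
    {a : Euc N} {R : ℝ} (hR : 0 < R)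
    (hΔ : ∀ z ∈ ball a R, ∑ i, d2 g z (EuclideanSpace.single i 1) = 0) :
    ∫ y, g (a + R • y) * sqBump N y = g a * ∫ y, sqBump N y := by
  have hη := continuous_sqBump N
  have hgc : Continuous g := hg.continuous
  have hg1 : Continuous (fderiv ℝ g) := hg.continuous_fderiv (by norm_num)
  let H : ℝ → Euc N → ℝ := fun r y => fderiv ℝ g (a + r • y) y * sqBump N y
  have hHc : Continuous (Function.uncurry H) := by
    simp only [H, Function.uncurry_def]
    fun_prop
  have hftc : ∀ y, ∫ r in (0 : ℝ)..R, H r y = (g (a + R • y) - g a) * sqBump N y := by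
    intro y
    have hd : ∀ r : ℝ, HasDerivAt (fun r : ℝ => g (a + r • y) * sqBump N y) (H r y) r := by
      intro r
      have h1 : HasDerivAt (fun r : ℝ => a + r • y) y r := by
        simpa using ((hasDerivAt_id r).smul_const y).const_add a
      exact (((hg.differentiable (by norm_num)) (a + r • y)).hasFDerivAt.comp_hasDerivAt r
        h1).mul_const _
    rw [intervalIntegral.integral_eq_sub_of_hasDerivAt (fun r _ => hd r)]
    · simp; ring
    · exact Continuous.intervalIntegrable (by exact hHc.comp (Continuous.prodMk_left y)) _ _
  have hoff : ∀ r y, y ∉ closedBall (0 : Euc N) 1 → H r y = 0 := by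
    intro r y hy
    simp only [H]
    rw [sqBump_eq_zero fun h => hy (ball_subset_closedBall h), mul_zero]
  have hHi : Integrable (Function.uncurry H) ((volume.restrict (Ioc 0 R)).prod
      (volume.restrict (closedBall (0 : Euc N) 1))) := by
    rw [Measure.prod_restrict]
    exact (hHc.continuousOn.integrableOn_compact
      (isCompact_Icc.prod (isCompact_closedBall (0 : Euc N) 1))).mono_set
      (prod_mono Ioc_subset_Icc_self subset_rfl)
  have hswap : ∫ y, ∫ r in (0 : ℝ)..R, H r y = 0 := by
    calc ∫ y, ∫ r in (0 : ℝ)..R, H r y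
        = ∫ y in closedBall (0 : Euc N) 1, ∫ r in Ioc 0 R, H r y := by
          rw [setIntegral_eq_integral_of_forall_compl_eq_zero]
          · simp_rw [intervalIntegral.integral_of_le hR.le]
          · intro y hy
            simp [hoff _ y hy]
      _ = ∫ r in Ioc 0 R, ∫ y in closedBall (0 : Euc N) 1, H r y :=
          (integral_integral_swap hHi).symm
      _ = ∫ r in Ioc 0 R, (0 : ℝ) := by
          refine setIntegral_congr_fun measurableSet_Ioc fun r hr => ?_
          rw [setIntegral_eq_integral_of_forall_compl_eq_zero (hoff r)]
          exact integral_fderiv_mul_sqBump_eq_zero hg hr.1.le hr.2 hR hΔ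
      _ = 0 := by simp
  simp_rw [hftc, sub_mul] at hswap
  rw [integral_sub, integral_const_mul] at hswap
  · linarith
  · exact Continuous.integrable_of_hasCompactSupport (by fun_prop)
      (hasCompactSupport_sqBump N).mul_left
  · exact Continuous.integrable_of_hasCompactSupport (by fun_prop)
      (hasCompactSupport_sqBump N).mul_left

lemma enorm_le_lintegral_of_contDiff {N : ℕ} {g : Euc N → ℝ} (hg : ContDiff ℝ 2 g)
    {a : Euc N} {R : ℝ} (hR : 0 < R)
    (hΔ : ∀ z ∈ ball a R, ∑ i, d2 g z (EuclideanSpace.single i 1) = 0) :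
    ‖g a‖ₑ ≤ ENNReal.ofReal ((∫ y, sqBump N y)⁻¹ * R⁻¹ ^ N) * ∫⁻ y in ball a R, ‖g y‖ₑ := by
  have hpos := integral_sqBump_pos N
  have hmv := integral_mul_sqBump_eq hg hR hΔ
  have h1 : ‖g a * ∫ y, sqBump N y‖ₑ ≤ ∫⁻ y in ball (0 : Euc N) 1, ‖g (a + R • y)‖ₑ := by
    rw [← hmv]
    refine (enorm_integral_le_lintegral_enorm _).trans ?_
    rw [← lintegral_indicator measurableSet_ball]
    refine lintegral_mono fun y => ?_
    by_cases hy : y ∈ ball (0 : Euc N) 1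
    · rw [indicator_of_mem hy, enorm_mul]
      refine mul_le_of_le_one_right' ?_
      rw [Real.enorm_of_nonneg (sqBump_nonneg y)]
      exact ENNReal.ofReal_le_one.2 (sqBump_le_one y)
    · simp [sqBump_eq_zero hy]
  have h2 : ∫⁻ y in ball (0 : Euc N) 1, ‖g (a + R • y)‖ₑ =
      ENNReal.ofReal (R⁻¹ ^ N) * ∫⁻ y in ball a R, ‖g y‖ₑ := by
    have hme : MeasurableEmbedding (fun y : Euc N => a + R • y) :=
      ((Homeomorph.smulOfNeZero R hR.ne').trans (Homeomorph.addLeft a)).measurableEmbedding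
    have hmap : Measure.map (fun y : Euc N => a + R • y) volume =
        ENNReal.ofReal (R⁻¹ ^ N) • volume := by
      have : (fun y : Euc N => a + R • y) = (fun y => a + y) ∘ (fun y => R • y) := rfl
      rw [this, ← Measure.map_map (by fun_prop) (by fun_prop), Measure.map_addHaar_smul _ hR.ne',
        Measure.map_smul, map_add_left_eq_self]
      simp [abs_of_pos hR]
    have hpre : (fun y : Euc N => a + R • y) ⁻¹' (ball a R) = ball 0 1 := by
      ext y
      simp only [mem_preimage, mem_ball, dist_eq_norm, add_sub_cancel_left, norm_smul,
        Real.norm_eq_abs, abs_of_pos hR, sub_zero]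
      constructor <;> intro h <;> nlinarith
    rw [← hpre, ← hme.lintegral_map (μ := volume.restrict _) (fun y => ‖g y‖ₑ),
      ← hme.restrict_map, hmap, Measure.restrict_smul, lintegral_smul_measure, smul_eq_mul]
  rw [ENNReal.ofReal_mul (inv_nonneg.2 hpos.le), mul_assoc, ← h2, ENNReal.ofReal_inv_of_pos hpos]
  rw [enorm_mul, Real.enorm_of_nonneg hpos.le] at h1
  rw [mul_comm, ← div_eq_mul_inv, ENNReal.le_div_iff_mul_le (by simp [hpos]) (by simp)]
  exact h1

/-- The `L¹` sub-mean value property of harmonic functions. -/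
lemma enorm_le_lintegral_of_harmonicOnE {N : ℕ} {f : Euc N → ℝ} {U : Set (Euc N)} (hU : IsOpen U)
    (hf : HarmonicOnE f U) {a : Euc N} {R : ℝ} (hR : 0 < R) (haU : closedBall a R ⊆ U) :
    ‖f a‖ₑ ≤ ENNReal.ofReal ((∫ y, sqBump N y)⁻¹ * R⁻¹ ^ N) * ∫⁻ y in ball a R, ‖f y‖ₑ := by
  obtain ⟨χ, hχs, hχc, hχ⟩ : ∃ χ : Euc N → ℝ, tsupport χ ⊆ U ∧ ContDiff ℝ 2 χ ∧
      ∀ y ∈ closedBall a R, χ y = 1 := by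
    obtain ⟨δ, hδ, hδU⟩ := (isCompact_closedBall a R).exists_cthickening_subset_open hU haU
    let b : ContDiffBump a := ⟨R, R + δ, hR, by linarith⟩
    refine ⟨b, ?_, b.contDiff, fun y hy => b.one_of_mem_closedBall hy⟩
    rw [b.tsupport_eq]
    refine subset_trans ?_ hδU
    rw [cthickening_closedBall hδ.le hR.le, add_comm]
  let g : Euc N → ℝ := fun y => χ y * f y
  have hg : ContDiff ℝ 2 g := by
    rw [contDiff_iff_contDiffAt]
    intro y
    by_cases hy : y ∈ tsupport χ
    · exact hχc.contDiffAt.mul (hf.1.contDiffAt (hU.mem_nhds (hχs hy)))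
    · have : g =ᶠ[𝓝 y] fun _ => 0 := by
        filter_upwards [notMem_tsupport_iff_eventuallyEq.1 hy] with u hu
        simp [g, hu]
      exact contDiffAt_const.congr_of_eventuallyEq this
  have hfg : ∀ y ∈ closedBall a R, g y = f y := fun y hy => by simp [g, hχ y hy]
  have h := enorm_le_lintegral_of_contDiff hg (a := a) hR fun z hz => by
    have : g =ᶠ[𝓝 z] f := by
      filter_upwards [isOpen_ball.mem_nhds hz] with u hu
      exact hfg u (ball_subset_closedBall hu)
    rw [← hf.2 z (haU (ball_subset_closedBall hz))]
    simp only [d2, (this.iteratedFDeriv ℝ 2).eq_of_nhds]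
  rw [hfg a (mem_closedBall_self hR.le)] at h
  rwa [setLIntegral_congr_fun measurableSet_ball (g := fun y => ‖f y‖ₑ)
    (fun y hy => by simp only [hfg y (ball_subset_closedBall hy)])] at h

/-- The `L^p` sub-mean value property of harmonic functions for `0 < p ≤ 1`. -/
lemma exists_enorm_rpow_le_lintegral (N : ℕ) {p : ℝ} (hp0 : 0 < p) (hp1 : p ≤ 1) :
    ∃ K : ℝ≥0∞, K ≠ ∞ ∧ ∀ (f : Euc N → ℝ) (U : Set (Euc N)), IsOpen U → HarmonicOnE f U →
      ∀ (a : Euc N) (R : ℝ), 0 < R → closedBall a R ⊆ U →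
        ‖f a‖ₑ ^ p * ENNReal.ofReal R ^ N ≤ K * ∫⁻ y in ball a R, ‖f y‖ₑ ^ p := by
  set c : ℝ≥0∞ := ENNReal.ofReal (∫ y, sqBump N y)⁻¹ with hc
  refine ⟨((2 : ℝ≥0∞) ^ N * c ^ p) ^ p⁻¹, by finiteness, ?_⟩
  intro f U hU hf a R hR haU
  set I : ℝ≥0∞ := ∫⁻ y in ball a R, ‖f y‖ₑ ^ p with hI
  set A : ℝ≥0∞ := ⨆ x ∈ ball a R, ‖f x‖ₑ ^ p * ENNReal.ofReal (R - dist x a) ^ N with hA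
  have hAle : ∀ x ∈ ball a R, ‖f x‖ₑ ^ p * ENNReal.ofReal (R - dist x a) ^ N ≤ A :=
    fun x hx => le_iSup₂ (f := fun x (_ : x ∈ ball a R) =>
      ‖f x‖ₑ ^ p * ENNReal.ofReal (R - dist x a) ^ N) x hx
  have hAtop : A ≠ ∞ := by
    obtain ⟨B, hB⟩ := (isCompact_closedBall a R).exists_bound_of_continuousOn
      (hf.1.continuousOn.mono haU)
    have : A ≤ ENNReal.ofReal B ^ p * ENNReal.ofReal R ^ N := by
      refine iSup₂_le fun x hx => ?_
      gcongr
      · rw [← ofReal_norm]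
        exact ENNReal.ofReal_le_ofReal (hB x (ball_subset_closedBall hx))
      · linarith [dist_nonneg (x := x) (y := a)]
    exact ne_top_of_le_ne_top (by finiteness) this
  have hmain : A ≤ (2 : ℝ≥0∞) ^ N * c ^ p * (A ^ (1 - p) * I ^ p) := by
    refine iSup₂_le fun x hx => ?_
    have hx' : dist x a < R := hx
    set d : ℝ := (R - dist x a) / 2 with hd
    have hd0 : 0 < d := by rw [hd]; linarith
    set D : ℝ≥0∞ := ENNReal.ofReal d ^ N with hD
    have hD0 : D ≠ 0 := by simp [hD, hd0]
    have hDt : D ≠ ∞ := by finiteness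
    have hsub : ∀ y ∈ closedBall x d, d ≤ R - dist y a := by
      intro y hy
      have h1 : dist y x ≤ d := hy
      linarith [dist_triangle y x a]
    have hball : ∀ y ∈ closedBall x d, y ∈ ball a R := by
      intro y hy
      have := hsub y hy
      rw [mem_ball]; linarith
    have hfy : ∀ y ∈ ball x d, ‖f y‖ₑ ≤ ‖f y‖ₑ ^ p * (A * D⁻¹) ^ ((1 - p) / p) := by
      intro y hy
      have hy' := ball_subset_closedBall hy
      have h1 : ‖f y‖ₑ ^ p ≤ A * D⁻¹ := by
        rw [← div_eq_mul_inv, ENNReal.le_div_iff_mul_le (Or.inl hD0) (Or.inl hDt)]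
        refine le_trans ?_ (hAle y (hball y hy'))
        rw [hD]
        gcongr
        exact hsub y hy'
      calc ‖f y‖ₑ = ‖f y‖ₑ ^ p * ‖f y‖ₑ ^ (1 - p) := by
            rw [← ENNReal.rpow_add_of_nonneg _ _ hp0.le (by linarith)]; simp
        _ = ‖f y‖ₑ ^ p * (‖f y‖ₑ ^ p) ^ ((1 - p) / p) := by
            rw [← ENNReal.rpow_mul, mul_div_cancel₀ _ hp0.ne']
        _ ≤ _ := by
            gcongr
    have hE : (A * D⁻¹) ^ ((1 - p) / p) ≠ ∞ := by
      refine ENNReal.rpow_ne_top_of_nonneg (div_nonneg (by linarith) hp0.le) ?_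
      exact ENNReal.mul_ne_top hAtop (ENNReal.inv_ne_top.2 hD0)
    have h2 : ‖f x‖ₑ ≤ c * D⁻¹ * (I * (A * D⁻¹) ^ ((1 - p) / p)) := by
      have h3 := enorm_le_lintegral_of_harmonicOnE hU hf hd0
        ((fun y hy => haU (ball_subset_closedBall (hball y hy))) : closedBall x d ⊆ U)
      have h4 : ENNReal.ofReal ((∫ y, sqBump N y)⁻¹ * d⁻¹ ^ N) = c * D⁻¹ := by
        rw [ENNReal.ofReal_mul (inv_nonneg.2 (integral_sqBump_pos N).le), hc, hD,
          ENNReal.ofReal_pow (inv_nonneg.2 hd0.le), ENNReal.ofReal_inv_of_pos hd0,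
          ENNReal.inv_pow]
      rw [h4] at h3
      refine h3.trans ?_
      gcongr
      rw [hI, ← lintegral_mul_const' _ _ hE]
      refine (setLIntegral_mono' measurableSet_ball hfy).trans ?_
      exact lintegral_mono_set fun y hy => hball y (ball_subset_closedBall hy)
    have h5 : ENNReal.ofReal (R - dist x a) ^ N = 2 ^ N * D := by
      have h6 : R - dist x a = 2 * d := by rw [hd]; ring
      rw [hD, ← mul_pow, h6, ENNReal.ofReal_mul (by norm_num), ENNReal.ofReal_ofNat]
    calc ‖f x‖ₑ ^ p * ENNReal.ofReal (R - dist x a) ^ N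
        ≤ (c * D⁻¹ * (I * (A * D⁻¹) ^ ((1 - p) / p))) ^ p * (2 ^ N * D) := by
          rw [h5]; gcongr
      _ = 2 ^ N * c ^ p * (A ^ (1 - p) * I ^ p) * (D⁻¹ ^ p * D⁻¹ ^ (1 - p) * D) := by
          rw [ENNReal.mul_rpow_of_nonneg _ _ hp0.le, ENNReal.mul_rpow_of_nonneg _ _ hp0.le,
            ENNReal.mul_rpow_of_nonneg _ _ hp0.le, ← ENNReal.rpow_mul, div_mul_cancel₀ _ hp0.ne',
            ENNReal.mul_rpow_of_nonneg _ _ (by linarith)]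
          ring
      _ = 2 ^ N * c ^ p * (A ^ (1 - p) * I ^ p) := by
          rw [← ENNReal.rpow_add_of_nonneg _ _ hp0.le (by linarith)]
          simp [ENNReal.inv_mul_cancel hD0 hDt]
  have hfin : A ≤ ((2 : ℝ≥0∞) ^ N * c ^ p) ^ p⁻¹ * I := by
    rcases eq_or_ne A 0 with h0 | h0
    · simp [h0]
    · rw [← ENNReal.rpow_le_rpow_iff hp0, ENNReal.mul_rpow_of_nonneg _ _ hp0.le,
        ENNReal.rpow_inv_rpow hp0.ne']
      have h1 : A ^ (1 - p) ≠ 0 := by simp [h0, hAtop]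
      have h2 : A ^ (1 - p) ≠ ∞ := ENNReal.rpow_ne_top_of_nonneg (by linarith) hAtop
      rw [← ENNReal.mul_le_mul_iff_right h1 h2,
        ← ENNReal.rpow_add_of_nonneg _ _ (by linarith) hp0.le]
      simp only [sub_add_cancel, ENNReal.rpow_one]
      calc A ≤ _ := hmain
        _ = _ := by ring
  refine le_trans ?_ hfin
  simpa using hAle a (mem_ball_self hR)

/-- A reverse Hölder type inequality: if `F` is pointwise controlled by a weighted `L^p` norm
with `p ≤ 1`, then so is its `L¹` norm. -/
lemma lintegral_rpow_le_of_pointwise {X : Type*} [MeasurableSpace X] {μ : Measure X}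
    {F u : X → ℝ≥0∞} {p : ℝ} (hp0 : 0 < p) (hp1 : p ≤ 1) (hF : AEMeasurable F μ)
    (hu : AEMeasurable u μ) (hu0 : ∀ᵐ w ∂μ, u w ≠ 0) (hut : ∀ᵐ w ∂μ, u w ≠ ∞) {K : ℝ≥0∞}
    (h : ∀ᵐ w ∂μ, F w ^ p * u w ^ p ≤ K * ∫⁻ w, F w ^ p * u w ^ (p - 1) ∂μ) :
    (∫⁻ w, F w ∂μ) ^ p ≤ K ^ (1 - p) * ∫⁻ w, F w ^ p * u w ^ (p - 1) ∂μ := by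
  set G := ∫⁻ w, F w ^ p * u w ^ (p - 1) ∂μ with hG
  have hq : 0 ≤ (1 - p) / p := div_nonneg (by linarith) hp0.le
  have h1 : ∫⁻ w, F w ∂μ ≤ G * (K * G) ^ ((1 - p) / p) := by
    have hm : AEMeasurable (fun w => F w ^ p * u w ^ (p - 1)) μ :=
      (hF.pow_const p).mul (hu.pow_const (p - 1))
    nth_rewrite 1 [hG]
    rw [← lintegral_mul_const'' _ hm]
    refine lintegral_mono_ae ?_
    filter_upwards [hu0, hut, h] with w h0 ht hw
    calc F w = F w ^ p * F w ^ (1 - p) * (u w ^ (p - 1) * u w ^ (1 - p)) := by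
          rw [← ENNReal.rpow_add_of_nonneg _ _ hp0.le (by linarith),
            ← ENNReal.rpow_add _ _ h0 ht]
          simp
      _ = F w ^ p * u w ^ (p - 1) * (F w ^ p * u w ^ p) ^ ((1 - p) / p) := by
          rw [ENNReal.mul_rpow_of_nonneg _ _ hq, ← ENNReal.rpow_mul, ← ENNReal.rpow_mul,
            mul_div_cancel₀ _ hp0.ne']
          ring
      _ ≤ _ := by gcongr
  calc (∫⁻ w, F w ∂μ) ^ p ≤ (G * (K * G) ^ ((1 - p) / p)) ^ p := by gcongr
    _ = K ^ (1 - p) * (G ^ p * G ^ (1 - p)) := by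
        rw [ENNReal.mul_rpow_of_nonneg _ _ hp0.le, ← ENNReal.rpow_mul, div_mul_cancel₀ _ hp0.ne',
          ENNReal.mul_rpow_of_nonneg _ _ (by linarith)]
        ring
    _ = K ^ (1 - p) * G := by
        rw [← ENNReal.rpow_add_of_nonneg _ _ hp0.le (by linarith)]
        simp

lemma contDiffAt_pow_mul_rpow {j k : ℕ} {β ρ u : ℝ} (hρ : 0 ≤ ρ) (hu : 0 < u) :
    ContDiffAt ℝ k (fun u : ℝ => u ^ j * (ρ + u ^ 2) ^ (-β)) u := by
  have : ρ + u ^ 2 ≠ 0 := by positivity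
  exact (contDiffAt_id.pow j).mul
    ((contDiffAt_const.add (contDiffAt_id.pow 2)).rpow_const_of_ne this)

lemma deriv_pow_mul_rpow (j : ℕ) (β : ℝ) {ρ u : ℝ} (hρ : 0 ≤ ρ) (hu : 0 < u) :
    deriv (fun u : ℝ => u ^ j * (ρ + u ^ 2) ^ (-β)) u =
      j * (u ^ (j - 1) * (ρ + u ^ 2) ^ (-β)) +
        (-2 * β) * (u ^ (j + 1) * (ρ + u ^ 2) ^ (-(β + 1))) := by
  have h0 : ρ + u ^ 2 ≠ 0 := by positivity
  have h1 : HasDerivAt (fun u : ℝ => ρ + u ^ 2) (2 * u) u := by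
    simpa using (hasDerivAt_pow 2 u).const_add ρ
  refine ((hasDerivAt_pow j u).mul (h1.rpow_const (p := -β) (Or.inl h0))).deriv.trans ?_
  rw [show -β - 1 = -(β + 1) by ring]
  ring

/-- Derivatives of `u ^ j * (ρ + u ^ 2) ^ (-β)` obey the bound dictated by homogeneity. -/
lemma exists_abs_iteratedDeriv_pow_mul_rpow_le (k : ℕ) : ∀ (j : ℕ) (β : ℝ), ∃ C : ℝ, 0 ≤ C ∧
    ∀ ρ : ℝ, 0 ≤ ρ → ∀ u : ℝ, 0 < u →
      |iteratedDeriv k (fun u : ℝ => u ^ j * (ρ + u ^ 2) ^ (-β)) u| ≤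
        C * (ρ + u ^ 2) ^ (((j : ℝ) - k) / 2 - β) := by
  induction k with
  | zero =>
    intro j β
    refine ⟨1, zero_le_one, fun ρ hρ u hu => ?_⟩
    have h0 : 0 < ρ + u ^ 2 := by positivity
    rw [iteratedDeriv_zero, abs_of_nonneg (by positivity), one_mul, sub_eq_add_neg _ β,
      Real.rpow_add h0]
    gcongr
    have h1 : u ≤ (ρ + u ^ 2) ^ (1 / 2 : ℝ) := by
      rw [← Real.sqrt_eq_rpow]
      exact Real.le_sqrt_of_sq_le (by linarith)
    calc u ^ j ≤ ((ρ + u ^ 2) ^ (1 / 2 : ℝ)) ^ j := by gcongr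
      _ = _ := by
        rw [← Real.rpow_natCast, ← Real.rpow_mul h0.le]
        congr 1
        push_cast
        ring
  | succ k ih =>
    intro j β
    obtain ⟨C₁, hC₁, h₁⟩ := ih (j - 1) β
    obtain ⟨C₂, hC₂, h₂⟩ := ih (j + 1) (β + 1)
    refine ⟨j * C₁ + |-2 * β| * C₂, by positivity, fun ρ hρ u hu => ?_⟩
    have he : deriv (fun u : ℝ => u ^ j * (ρ + u ^ 2) ^ (-β)) =ᶠ[𝓝 u] fun u =>
        j * (u ^ (j - 1) * (ρ + u ^ 2) ^ (-β)) +
        (-2 * β) * (u ^ (j + 1) * (ρ + u ^ 2) ^ (-(β + 1))) := by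
      filter_upwards [eventually_gt_nhds hu] with v hv
      exact deriv_pow_mul_rpow j β hρ hv
    rw [iteratedDeriv_succ', he.iteratedDeriv_eq,
      iteratedDeriv_fun_add (contDiffAt_const.mul (contDiffAt_pow_mul_rpow hρ hu))
        (contDiffAt_const.mul (contDiffAt_pow_mul_rpow hρ hu)),
      iteratedDeriv_const_mul_field, iteratedDeriv_const_mul_field, add_mul]
    refine (abs_add_le _ _).trans (add_le_add ?_ ?_)
    · rw [abs_mul, Nat.abs_cast, mul_assoc]
      rcases Nat.eq_zero_or_pos j with rfl | hj
      · simp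
      · refine mul_le_mul_of_nonneg_left ?_ (Nat.cast_nonneg j)
        refine (h₁ ρ hρ u hu).trans_eq ?_
        congr 2
        push_cast [Nat.cast_pred hj]
        ring
    · rw [abs_mul, mul_assoc]
      refine mul_le_mul_of_nonneg_left ?_ (abs_nonneg _)
      refine (h₂ ρ hρ u hu).trans_eq ?_
      congr 2
      push_cast
      ring

/-- Size estimate for the harmonic Bergman kernel. -/
lemma exists_abs_Qker_le (n m : ℕ) : ∃ C : ℝ, 0 ≤ C ∧ ∀ (x y : Euc n) (t s : ℝ), 0 < t → 0 < s →
    |Qker n m x t y s| ≤ C * (‖x - y‖ ^ 2 + (t + s) ^ 2) ^ (-((n : ℝ) + m + 1) / 2) := by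
  obtain ⟨C, hC, h⟩ := exists_abs_iteratedDeriv_pow_mul_rpow_le (m + 1) 1 (((n : ℝ) + 1) / 2)
  refine ⟨|(-2 : ℝ) ^ (m + 1) / (Nat.factorial m : ℝ)| * (|cP n| * C), by positivity,
    fun x y t s ht hs => ?_⟩
  have hP : (fun u => Pker n (x - y) u) = fun u : ℝ =>
      cP n * (u ^ 1 * (‖x - y‖ ^ 2 + u ^ 2) ^ (-(((n : ℝ) + 1) / 2))) := by
    ext u
    rw [Pker, Real.rpow_neg (by positivity)]
    ring
  rw [Qker, hP, iteratedDeriv_const_mul_field, abs_mul, abs_mul, mul_assoc, mul_assoc]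
  gcongr
  refine (h (‖x - y‖ ^ 2) (by positivity) (t + s) (by positivity)).trans_eq ?_
  congr 2
  push_cast
  ring

lemma lintegral_rpow_norm_sq_add_sq (n : ℕ) (q : ℝ) (y : Euc n) {τ : ℝ} (hτ : 0 < τ) :
    ∫⁻ x : Euc n, ENNReal.ofReal ((‖x - y‖ ^ 2 + τ ^ 2) ^ (-q / 2)) =
      ENNReal.ofReal (τ ^ ((n : ℝ) - q)) *
        ∫⁻ x : Euc n, ENNReal.ofReal ((1 + ‖x‖ ^ 2) ^ (-q / 2)) := by
  rw [lintegral_sub_right_eq_self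
    (fun x : Euc n => ENNReal.ofReal ((‖x‖ ^ 2 + τ ^ 2) ^ (-q / 2))) y]
  have h1 : ∀ x : Euc n, ENNReal.ofReal ((‖x‖ ^ 2 + τ ^ 2) ^ (-q / 2)) =
      ENNReal.ofReal (τ ^ (-q)) * ENNReal.ofReal ((1 + ‖τ⁻¹ • x‖ ^ 2) ^ (-q / 2)) := by
    intro x
    rw [← ENNReal.ofReal_mul (by positivity)]
    congr 1
    have h2 : ‖x‖ ^ 2 + τ ^ 2 = τ ^ 2 * (1 + ‖τ⁻¹ • x‖ ^ 2) := by
      rw [norm_smul, norm_inv, Real.norm_of_nonneg hτ.le]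
      field_simp
      ring
    rw [h2, Real.mul_rpow (by positivity) (by positivity), ← Real.rpow_natCast τ 2,
      ← Real.rpow_mul hτ.le]
    congr 2
    push_cast
    ring
  simp_rw [h1]
  rw [lintegral_const_mul' _ _ ENNReal.ofReal_ne_top]
  have hme : MeasurableEmbedding (fun x : Euc n => τ⁻¹ • x) :=
    (Homeomorph.smulOfNeZero τ⁻¹ (inv_ne_zero hτ.ne')).measurableEmbedding
  have h3 : ∫⁻ x : Euc n, ENNReal.ofReal ((1 + ‖τ⁻¹ • x‖ ^ 2) ^ (-q / 2)) =
      ENNReal.ofReal (τ ^ n) * ∫⁻ x : Euc n, ENNReal.ofReal ((1 + ‖x‖ ^ 2) ^ (-q / 2)) := by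
    rw [← hme.lintegral_map (μ := volume)
      (fun x : Euc n => ENNReal.ofReal ((1 + ‖x‖ ^ 2) ^ (-q / 2))),
      Measure.map_addHaar_smul _ (inv_ne_zero hτ.ne'), lintegral_smul_measure, smul_eq_mul]
    simp [abs_of_pos hτ]
  rw [h3, ← mul_assoc, ← ENNReal.ofReal_mul (by positivity), ← Real.rpow_natCast τ n,
    ← Real.rpow_add hτ]
  congr 3
  ring

lemma lintegral_Ioi_add_rpow_mul_rpow_le {α b s : ℝ} (hα : -1 < α) (hb : α + 1 < b) (hs : 0 < s) :
    ∫⁻ t in Ioi (0 : ℝ), ENNReal.ofReal ((t + s) ^ (-b)) * ENNReal.ofReal (t ^ α) ≤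
      ENNReal.ofReal ((1 / (α + 1) + 1 / (b - α - 1)) * s ^ (α + 1 - b)) := by
  have hα1 : 0 < α + 1 := by linarith
  have hb1 : 0 < b - α - 1 := by linarith
  have hb0 : -b ≤ 0 := by linarith
  have h1 : ∫⁻ t in Ioc 0 s, ENNReal.ofReal ((t + s) ^ (-b)) * ENNReal.ofReal (t ^ α) ≤
      ENNReal.ofReal (1 / (α + 1) * s ^ (α + 1 - b)) := by
    calc ∫⁻ t in Ioc 0 s, ENNReal.ofReal ((t + s) ^ (-b)) * ENNReal.ofReal (t ^ α)
        ≤ ∫⁻ t in Ioc 0 s, ENNReal.ofReal (s ^ (-b)) * ENNReal.ofReal (t ^ α) := by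
          refine setLIntegral_mono' measurableSet_Ioc fun t ht => ?_
          gcongr ENNReal.ofReal ?_ * _
          exact Real.rpow_le_rpow_of_nonpos hs (by linarith [ht.1]) hb0
      _ = ENNReal.ofReal (s ^ (-b)) * ENNReal.ofReal (∫ t in Ioc 0 s, t ^ α) := by
          rw [lintegral_const_mul' _ _ ENNReal.ofReal_ne_top, ofReal_integral_eq_lintegral_ofReal]
          · exact (intervalIntegrable_iff_integrableOn_Ioc_of_le hs.le).1
              (intervalIntegral.intervalIntegrable_rpow' hα)
          · filter_upwards [ae_restrict_mem measurableSet_Ioc] with t ht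
            exact Real.rpow_nonneg ht.1.le _
      _ = ENNReal.ofReal (1 / (α + 1) * s ^ (α + 1 - b)) := by
          have e : s ^ (α + 1 - b) = s ^ (-b) * s ^ (α + 1) := by
            rw [← Real.rpow_add hs]
            congr 1
            ring
          rw [← intervalIntegral.integral_of_le hs.le, integral_rpow (Or.inl hα),
            ← ENNReal.ofReal_mul (by positivity), Real.zero_rpow hα1.ne', e]
          congr 1
          ring
  have h2 : ∫⁻ t in Ioi s, ENNReal.ofReal ((t + s) ^ (-b)) * ENNReal.ofReal (t ^ α) ≤
      ENNReal.ofReal (1 / (b - α - 1) * s ^ (α + 1 - b)) := by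
    calc ∫⁻ t in Ioi s, ENNReal.ofReal ((t + s) ^ (-b)) * ENNReal.ofReal (t ^ α)
        ≤ ∫⁻ t in Ioi s, ENNReal.ofReal (t ^ (α - b)) := by
          refine setLIntegral_mono' measurableSet_Ioi fun t ht => ?_
          have ht0 : 0 < t := hs.trans ht
          rw [sub_eq_neg_add, Real.rpow_add ht0, ENNReal.ofReal_mul (by positivity)]
          gcongr ENNReal.ofReal ?_ * _
          exact Real.rpow_le_rpow_of_nonpos ht0 (by linarith) hb0
      _ = ENNReal.ofReal (∫ t in Ioi s, t ^ (α - b)) := by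
          rw [ofReal_integral_eq_lintegral_ofReal]
          · exact integrableOn_Ioi_rpow_of_lt (by linarith) hs
          · filter_upwards [ae_restrict_mem measurableSet_Ioi] with t ht
            exact Real.rpow_nonneg (hs.trans ht).le _
      _ = ENNReal.ofReal (1 / (b - α - 1) * s ^ (α + 1 - b)) := by
          rw [integral_Ioi_rpow_of_lt (by linarith) hs,
            show α - b + 1 = -(b - α - 1) by ring, show α + 1 - b = -(b - α - 1) by ring]
          congr 1
          rw [neg_div_neg_eq]
          ring
  rw [← Ioc_union_Ioi_eq_Ioi hs.le, add_mul, ENNReal.ofReal_add (by positivity) (by positivity)]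
  exact (lintegral_union_le _ _ _).trans (add_le_add h1 h2)

instance sFinite_baseM (n : ℕ) : SFinite (baseM n) := by
  unfold baseM; infer_instance

lemma ae_baseM_pos (n : ℕ) : ∀ᵐ z ∂(baseM n), 0 < z.2 := by
  have h : baseM n = ((volume : Measure (Euc n)).prod volume).restrict (univ ×ˢ Ioi (0 : ℝ)) := by
    rw [baseM, ← Measure.prod_restrict, Measure.restrict_univ]
  rw [h]
  filter_upwards [ae_restrict_mem (MeasurableSet.univ.prod measurableSet_Ioi)] with z hz
  exact hz.2

/-- Integrals over the half space of negative powers of the distance to a reflected point. -/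
lemma exists_lintegral_dist_rpow_le (n : ℕ) {α q : ℝ} (hα : -1 < α) (hq : (n : ℝ) + 1 + α < q) :
    ∃ K : ℝ≥0∞, K ≠ ∞ ∧ ∀ (y : Euc n) (s : ℝ), 0 < s →
      ∫⁻ z, ENNReal.ofReal ((‖z.1 - y‖ ^ 2 + (z.2 + s) ^ 2) ^ (-q / 2)) *
        ENNReal.ofReal (z.2 ^ α) ∂(baseM n) ≤ K * ENNReal.ofReal (s ^ ((n : ℝ) + 1 + α - q)) := by
  set K₁ : ℝ≥0∞ := ∫⁻ x : Euc n, ENNReal.ofReal ((1 + ‖x‖ ^ 2) ^ (-q / 2)) with hK₁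
  have hK₁t : K₁ ≠ ∞ := by
    have h := integrable_rpow_neg_one_add_norm_sq (E := Euc n) (μ := volume) (r := q)
      (by rw [finrank_euclideanSpace_fin]; linarith)
    exact h.lintegral_lt_top.ne
  refine ⟨K₁ * ENNReal.ofReal (1 / (α + 1) + 1 / (q - n - α - 1)), by finiteness, fun y s hs => ?_⟩
  rw [baseM, lintegral_prod_symm _ (by fun_prop)]
  have h1 : ∀ t ∈ Ioi (0 : ℝ), ∫⁻ x : Euc n,
      ENNReal.ofReal ((‖x - y‖ ^ 2 + (t + s) ^ 2) ^ (-q / 2)) * ENNReal.ofReal (t ^ α) =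
      K₁ * (ENNReal.ofReal ((t + s) ^ (-(q - n))) * ENNReal.ofReal (t ^ α)) := by
    intro t ht
    have hts : 0 < t + s := add_pos ht hs
    rw [lintegral_mul_const' _ _ ENNReal.ofReal_ne_top, lintegral_rpow_norm_sq_add_sq n q y hts,
      neg_sub]
    ring
  rw [setLIntegral_congr_fun measurableSet_Ioi h1, lintegral_const_mul' _ _ hK₁t, mul_assoc]
  gcongr
  refine (lintegral_Ioi_add_rpow_mul_rpow_le hα (b := q - n) (by linarith) hs).trans_eq ?_
  have : 0 < α + 1 := by linarith
  have : 0 < q - n - α - 1 := by linarith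
  rw [← ENNReal.ofReal_mul (by positivity)]
  congr 3
  ring

/-- The identification of `ℝⁿ × ℝ` with `ℝⁿ⁺¹` given by `pt`. -/
def ptEquiv (n : ℕ) : Euc n × ℝ ≃ᵐ Euc (n + 1) :=
  ((MeasurableEquiv.prodCongr (MeasurableEquiv.toLp 2 (Fin n → ℝ)).symm
    (MeasurableEquiv.refl ℝ)).trans MeasurableEquiv.prodComm).trans
    ((MeasurableEquiv.piFinSuccAbove (fun _ : Fin (n + 1) => ℝ) (Fin.last n)).symm.trans
      (MeasurableEquiv.toLp 2 (Fin (n + 1) → ℝ)))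

lemma ptEquiv_apply {n : ℕ} (w : Euc n × ℝ) : ptEquiv n w = pt w.1 w.2 := by
  ext i
  simp [ptEquiv, pt]
  rfl

lemma measurePreserving_ptEquiv (n : ℕ) :
    MeasurePreserving (ptEquiv n) ((volume : Measure (Euc n)).prod volume) volume := by
  have h1 : MeasurePreserving (MeasurableEquiv.toLp 2 (Fin n → ℝ)).symm volume volume :=
    EuclideanSpace.volume_preserving_symm_measurableEquiv_toLp (Fin n)
  have h2 : MeasurePreserving (MeasurableEquiv.toLp 2 (Fin (n + 1) → ℝ)) volume volume :=
    PiLp.volume_preserving_toLp (Fin (n + 1))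
  have h3 := (volume_preserving_piFinSuccAbove (fun _ : Fin (n + 1) => ℝ) (Fin.last n)).symm
  exact ((Measure.measurePreserving_swap).comp
    (h1.prod (MeasurePreserving.id volume))).trans (h3.trans h2)

lemma pt_apply_castSucc {n : ℕ} (x : Euc n) (t : ℝ) (i : Fin n) : pt x t i.castSucc = x i := by
  simp [pt]

lemma pt_apply_last {n : ℕ} (x : Euc n) (t : ℝ) : pt x t (Fin.last n) = t := by
  simp [pt]

lemma dist_pt_sq {n : ℕ} (x y : Euc n) (t s : ℝ) :
    dist (pt x t) (pt y s) ^ 2 = ‖x - y‖ ^ 2 + (t - s) ^ 2 := by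
  rw [EuclideanSpace.dist_sq_eq, Fin.sum_univ_castSucc, EuclideanSpace.norm_sq_eq]
  simp [pt_apply_castSucc, pt_apply_last, Real.dist_eq]

lemma isOpen_upperHS (n : ℕ) : IsOpen (upperHS n) := by
  have : Continuous (fun z : Euc (n + 1) => z (Fin.last n)) := by fun_prop
  exact isOpen_lt continuous_const this

lemma pt_mem_upperHS {n : ℕ} {w : Euc n × ℝ} : pt w.1 w.2 ∈ upperHS n ↔ 0 < w.2 := by
  simp [upperHS, tp, pt_apply_last]

lemma measurable_pt (n : ℕ) : Measurable (fun w : Euc n × ℝ => pt w.1 w.2) := by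
  simp_rw [← ptEquiv_apply]
  exact (ptEquiv n).measurable

/-- Integrals over subsets of the half space, in the coordinates `(y, s)`. -/
lemma setLIntegral_eq_lintegral_baseM {n : ℕ} {B : Set (Euc (n + 1))}
    (hBU : B ⊆ upperHS n) (h : Euc (n + 1) → ℝ≥0∞) :
    ∫⁻ v in B, h v = ∫⁻ w in (fun w => pt w.1 w.2) ⁻¹' B, h (pt w.1 w.2) ∂(baseM n) := by
  have hbase : baseM n =
      ((volume : Measure (Euc n)).prod volume).restrict (univ ×ˢ Ioi (0 : ℝ)) := by
    rw [baseM, ← Measure.prod_restrict, Measure.restrict_univ]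
  have hsub : (fun w : Euc n × ℝ => pt w.1 w.2) ⁻¹' B ⊆ univ ×ˢ Ioi (0 : ℝ) :=
    fun w hw => ⟨mem_univ _, pt_mem_upperHS.1 (hBU hw)⟩
  rw [hbase, Measure.restrict_restrict_of_subset hsub,
    ← (measurePreserving_ptEquiv n).setLIntegral_comp_preimage_emb
      (ptEquiv n).measurableEmbedding]
  simp only [ptEquiv_apply, preimage]

lemma aemeasurable_enorm_comp_pt {n : ℕ} {f : Euc (n + 1) → ℝ}
    (hf : ContinuousOn f (upperHS n)) :
    AEMeasurable (fun w : Euc n × ℝ => ‖f (pt w.1 w.2)‖ₑ) (baseM n) := by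
  classical
  have hm : Measurable ((upperHS n).indicator f) :=
    hf.measurable_piecewise (g := fun _ => 0) continuousOn_const (isOpen_upperHS n).measurableSet
  refine ⟨fun w => ‖(upperHS n).indicator f (pt w.1 w.2)‖ₑ,
    (hm.comp (measurable_pt n)).enorm, ?_⟩
  filter_upwards [ae_baseM_pos n] with w hw
  rw [indicator_of_mem (pt_mem_upperHS.2 hw)]

/-- The size of `s ^ m * Q_m(z, w)`, up to a constant. -/
def kerSize (n m : ℕ) (z w : Euc n × ℝ) : ℝ :=
  w.2 ^ (m : ℝ) * (‖z.1 - w.1‖ ^ 2 + (z.2 + w.2) ^ 2) ^ (-((n : ℝ) + m + 1) / 2)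

/-- The weight in the linear integral that dominates the `p`-th power of the inner integral. -/
def kerWeight (n m : ℕ) (p : ℝ) (z w : Euc n × ℝ) : ℝ :=
  kerSize n m z w ^ p * (w.2 ^ (n + 1)) ^ (p - 1)

lemma kerSize_pos {n m : ℕ} {z w : Euc n × ℝ} (hz : 0 < z.2) (hw : 0 < w.2) :
    0 < kerSize n m z w := by
  unfold kerSize; positivity

@[fun_prop]
lemma measurable_kerWeight (n m : ℕ) (p : ℝ) :
    Measurable (fun zw : (Euc n × ℝ) × (Euc n × ℝ) => kerWeight n m p zw.1 zw.2) := by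
  unfold kerWeight kerSize; fun_prop

@[fun_prop]
lemma measurable_kerSize (n m : ℕ) (z : Euc n × ℝ) : Measurable (kerSize n m z) := by
  unfold kerSize; fun_prop

lemma snd_pos_of_dist_pt_lt {n : ℕ} {w w' : Euc n × ℝ}
    (h : dist (pt w'.1 w'.2) (pt w.1 w.2) ≤ w.2 / 2) (hw : 0 < w.2) :
    w.2 / 2 ≤ w'.2 ∧ w'.2 ≤ 3 * w.2 / 2 ∧ ‖w'.1 - w.1‖ ≤ w.2 / 2 := by
  have h1 := pow_le_pow_left₀ dist_nonneg h 2
  rw [dist_pt_sq] at h1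
  have h2 : |w'.2 - w.2| ≤ w.2 / 2 :=
    abs_le_of_sq_le_sq (by nlinarith [sq_nonneg ‖w'.1 - w.1‖]) (by positivity)
  have h3 : ‖w'.1 - w.1‖ ≤ w.2 / 2 :=
    le_of_sq_le_sq (by nlinarith [sq_nonneg (w'.2 - w.2)]) (by positivity)
  rw [abs_le] at h2
  exact ⟨by linarith, by linarith, h3⟩

lemma kerWeight_le_of_dist_le (n m : ℕ) {p : ℝ} (hp0 : 0 < p) (hp1 : p ≤ 1) {z w w' : Euc n × ℝ}
    (hz : 0 < z.2) (hw : 0 < w.2) (h : dist (pt w'.1 w'.2) (pt w.1 w.2) ≤ w.2 / 2) :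
    kerWeight n m p z w ≤
      ((2 ^ (m : ℝ) * 4 ^ (((n : ℝ) + m + 1) / 2)) ^ p * (2 ^ (n + 1)) ^ (1 - p)) *
        kerWeight n m p z w' := by
  obtain ⟨h1, h2, h3⟩ := snd_pos_of_dist_pt_lt h hw
  have hw' : 0 < w'.2 := by linarith
  have hs1 : w.2 ^ (m : ℝ) ≤ 2 ^ (m : ℝ) * w'.2 ^ (m : ℝ) := by
    rw [← Real.mul_rpow (by positivity) hw'.le]
    exact Real.rpow_le_rpow hw.le (by linarith) (by positivity)
  have hW : ‖z.1 - w'.1‖ ^ 2 + (z.2 + w'.2) ^ 2 ≤ 4 * (‖z.1 - w.1‖ ^ 2 + (z.2 + w.2) ^ 2) := by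
    have h4 : ‖z.1 - w'.1‖ ≤ ‖z.1 - w.1‖ + w.2 / 2 := by
      have := norm_sub_le_norm_sub_add_norm_sub z.1 w.1 w'.1
      rw [norm_sub_rev w.1] at this
      linarith
    have h5 := pow_le_pow_left₀ (norm_nonneg _) h4 2
    have h6 : (z.2 + w'.2) ^ 2 ≤ (z.2 + w.2 + w.2 / 2) ^ 2 :=
      pow_le_pow_left₀ (by positivity) (by linarith) 2
    nlinarith [sq_nonneg (‖z.1 - w.1‖ - w.2 / 2), mul_pos hz hw, sq_nonneg z.2]
  have hs2 : (‖z.1 - w.1‖ ^ 2 + (z.2 + w.2) ^ 2) ^ (-((n : ℝ) + m + 1) / 2) ≤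
      4 ^ (((n : ℝ) + m + 1) / 2) *
        (‖z.1 - w'.1‖ ^ 2 + (z.2 + w'.2) ^ 2) ^ (-((n : ℝ) + m + 1) / 2) := by
    have h7 := Real.rpow_le_rpow_of_nonpos (z := -((n : ℝ) + m + 1) / 2) (by positivity) hW
      (by rw [neg_div]; exact neg_nonpos.2 (by positivity))
    rw [Real.mul_rpow (by norm_num) (by positivity), neg_div, Real.rpow_neg (x := 4) (by norm_num),
      inv_mul_le_iff₀ (by positivity)] at h7
    rwa [neg_div]
  have hk : kerSize n m z w ≤ (2 ^ (m : ℝ) * 4 ^ (((n : ℝ) + m + 1) / 2)) * kerSize n m z w' := by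
    unfold kerSize
    calc _ ≤ _ := mul_le_mul hs1 hs2 (by positivity) (by positivity)
      _ = _ := by ring
  have hs3 : (w.2 ^ (n + 1)) ^ (p - 1) ≤ (2 ^ (n + 1)) ^ (1 - p) * (w'.2 ^ (n + 1)) ^ (p - 1) := by
    have h8 : w'.2 ^ (n + 1) ≤ 2 ^ (n + 1) * w.2 ^ (n + 1) := by
      rw [← mul_pow]
      exact pow_le_pow_left₀ hw'.le (by linarith) _
    have h9 := Real.rpow_le_rpow_of_nonpos (z := p - 1) (by positivity) h8 (by linarith)
    rw [Real.mul_rpow (by positivity) (by positivity), show p - 1 = -(1 - p) by ring,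
      Real.rpow_neg (x := 2 ^ (n + 1)) (by positivity), inv_mul_le_iff₀ (by positivity)] at h9
    rwa [show p - 1 = -(1 - p) by ring]
  have hk0 := kerSize_pos (m := m) hz hw
  have hk0' := kerSize_pos (m := m) hz hw'
  unfold kerWeight
  calc _ ≤ ((2 ^ (m : ℝ) * 4 ^ (((n : ℝ) + m + 1) / 2)) * kerSize n m z w') ^ p *
        ((2 ^ (n + 1)) ^ (1 - p) * (w'.2 ^ (n + 1)) ^ (p - 1)) :=
        mul_le_mul (Real.rpow_le_rpow hk0.le hk hp0.le) hs3 (by positivity) (by positivity)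
    _ = _ := by
        rw [Real.mul_rpow (by positivity) hk0'.le]
        ring

/-- The `p`-th power of the inner integral is dominated by a linear integral. -/
lemma exists_lintegral_kerSize_rpow_le (n m : ℕ) {p : ℝ} (hp0 : 0 < p) (hp1 : p ≤ 1) :
    ∃ K : ℝ≥0∞, K ≠ ∞ ∧ ∀ f : Euc (n + 1) → ℝ, HarmonicOnE f (upperHS n) →
      ∀ z : Euc n × ℝ, 0 < z.2 →
        (∫⁻ w, ‖f (pt w.1 w.2)‖ₑ * ENNReal.ofReal (kerSize n m z w) ∂(baseM n)) ^ p ≤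
          K * ∫⁻ w, ‖f (pt w.1 w.2)‖ₑ ^ p * ENNReal.ofReal (kerWeight n m p z w) ∂(baseM n) := by
  obtain ⟨K, hK, hKf⟩ := exists_enorm_rpow_le_lintegral (n + 1) hp0 hp1
  set L : ℝ := (2 ^ (m : ℝ) * 4 ^ (((n : ℝ) + m + 1) / 2)) ^ p * (2 ^ (n + 1)) ^ (1 - p) with hL
  have hL0 : 0 ≤ L := by positivity
  refine ⟨(2 ^ (n + 1) * K * ENNReal.ofReal L) ^ (1 - p), ?_, fun f hf z hz => ?_⟩
  · exact ENNReal.rpow_ne_top_of_nonneg (by linarith) (by finiteness)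
  have hfm := aemeasurable_enorm_comp_pt hf.1.continuousOn
  have hu0 : ∀ᵐ w ∂(baseM n), ENNReal.ofReal (w.2 ^ (n + 1)) ≠ 0 := by
    filter_upwards [ae_baseM_pos n] with w hw
    exact (ENNReal.ofReal_pos.2 (by positivity)).ne'
  have hFu : ∀ w : Euc n × ℝ, 0 < w.2 →
      (‖f (pt w.1 w.2)‖ₑ * ENNReal.ofReal (kerSize n m z w)) ^ p *
        ENNReal.ofReal (w.2 ^ (n + 1)) ^ (p - 1) =
      ‖f (pt w.1 w.2)‖ₑ ^ p * ENNReal.ofReal (kerWeight n m p z w) := by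
    intro w hw
    have hk0 := kerSize_pos (m := m) hz hw
    rw [ENNReal.mul_rpow_of_nonneg _ _ hp0.le, ENNReal.ofReal_rpow_of_pos hk0,
      ENNReal.ofReal_rpow_of_pos (by positivity), mul_assoc, ← ENNReal.ofReal_mul (by positivity)]
    rfl
  have hFu' : ∫⁻ w, (‖f (pt w.1 w.2)‖ₑ * ENNReal.ofReal (kerSize n m z w)) ^ p *
        ENNReal.ofReal (w.2 ^ (n + 1)) ^ (p - 1) ∂(baseM n) =
      ∫⁻ w, ‖f (pt w.1 w.2)‖ₑ ^ p * ENNReal.ofReal (kerWeight n m p z w) ∂(baseM n) := by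
    refine lintegral_congr_ae ?_
    filter_upwards [ae_baseM_pos n] with w hw using hFu w hw
  rw [← hFu']
  refine lintegral_rpow_le_of_pointwise
    (F := fun w : Euc n × ℝ => ‖f (pt w.1 w.2)‖ₑ * ENNReal.ofReal (kerSize n m z w))
    hp0 hp1 (hfm.mul (measurable_kerSize n m z).ennreal_ofReal.aemeasurable)
    (by fun_prop) hu0 (Eventually.of_forall fun _ => ENNReal.ofReal_ne_top) ?_
  rw [hFu']
  filter_upwards [ae_baseM_pos n] with w hw
  have hR : 0 < w.2 / 2 := by linarith
  have hsub : closedBall (pt w.1 w.2) (w.2 / 2) ⊆ upperHS n := by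
    intro v hv
    obtain ⟨w', rfl⟩ := (ptEquiv n).surjective v
    rw [ptEquiv_apply] at hv ⊢
    exact pt_mem_upperHS.2 (hR.trans_le (snd_pos_of_dist_pt_lt hv hw).1)
  have hmain := hKf f (upperHS n) (isOpen_upperHS n) hf (pt w.1 w.2) (w.2 / 2) hR hsub
  rw [setLIntegral_eq_lintegral_baseM (ball_subset_closedBall.trans hsub)] at hmain
  have hu : ENNReal.ofReal (w.2 ^ (n + 1)) =
      2 ^ (n + 1) * ENNReal.ofReal (w.2 / 2) ^ (n + 1) := by
    rw [← mul_pow, ENNReal.ofReal_pow hw.le]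
    congr 1
    rw [show (2 : ℝ≥0∞) = ENNReal.ofReal 2 by simp, ← ENNReal.ofReal_mul (by norm_num)]
    congr 1
    ring
  have hsplit : (‖f (pt w.1 w.2)‖ₑ * ENNReal.ofReal (kerSize n m z w)) ^ p *
        ENNReal.ofReal (w.2 ^ (n + 1)) ^ p =
      ‖f (pt w.1 w.2)‖ₑ ^ p * ENNReal.ofReal (kerWeight n m p z w) *
        ENNReal.ofReal (w.2 ^ (n + 1)) := by
    rw [← hFu w hw, mul_assoc]
    congr 1
    have hpos : 0 < w.2 ^ (n + 1) := by positivity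
    rw [ENNReal.ofReal_rpow_of_pos hpos, ENNReal.ofReal_rpow_of_pos hpos,
      ← ENNReal.ofReal_mul (by positivity), ← Real.rpow_add_one hpos.ne', sub_add_cancel]
  rw [hsplit, hu]
  calc ‖f (pt w.1 w.2)‖ₑ ^ p * ENNReal.ofReal (kerWeight n m p z w) *
        (2 ^ (n + 1) * ENNReal.ofReal (w.2 / 2) ^ (n + 1))
      = 2 ^ (n + 1) * (ENNReal.ofReal (kerWeight n m p z w) *
        (‖f (pt w.1 w.2)‖ₑ ^ p * ENNReal.ofReal (w.2 / 2) ^ (n + 1))) := by ring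
    _ ≤ 2 ^ (n + 1) * (ENNReal.ofReal (kerWeight n m p z w) *
        (K * ∫⁻ v in (fun v => pt v.1 v.2) ⁻¹' ball (pt w.1 w.2) (w.2 / 2),
          ‖f (pt v.1 v.2)‖ₑ ^ p ∂(baseM n))) := by gcongr
    _ = 2 ^ (n + 1) * K * ∫⁻ v in (fun v => pt v.1 v.2) ⁻¹' ball (pt w.1 w.2) (w.2 / 2),
          ENNReal.ofReal (kerWeight n m p z w) * ‖f (pt v.1 v.2)‖ₑ ^ p ∂(baseM n) := by
        rw [lintegral_const_mul' _ _ ENNReal.ofReal_ne_top]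
        ring
    _ ≤ 2 ^ (n + 1) * K * ∫⁻ v in (fun v => pt v.1 v.2) ⁻¹' ball (pt w.1 w.2) (w.2 / 2),
          ENNReal.ofReal L * (‖f (pt v.1 v.2)‖ₑ ^ p * ENNReal.ofReal (kerWeight n m p z v))
            ∂(baseM n) := by
        gcongr 2 ^ (n + 1) * K * ?_
        refine setLIntegral_mono' (measurable_pt n measurableSet_ball) fun v hv => ?_
        have h := ENNReal.ofReal_le_ofReal
          (kerWeight_le_of_dist_le n m hp0 hp1 hz hw (mem_ball.1 hv).le)
        rw [ENNReal.ofReal_mul hL0] at h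
        calc _ ≤ _ := mul_le_mul_left h _
          _ = _ := by ring
    _ ≤ 2 ^ (n + 1) * K * ∫⁻ v,
          ENNReal.ofReal L * (‖f (pt v.1 v.2)‖ₑ ^ p * ENNReal.ofReal (kerWeight n m p z v))
            ∂(baseM n) := by
        gcongr
        exact Measure.restrict_le_self
    _ = _ := by
        rw [lintegral_const_mul' _ _ ENNReal.ofReal_ne_top, mul_assoc (2 ^ (n + 1) * K)]

lemma normAp_eq_lintegral_baseM (n : ℕ) {f : Euc (n + 1) → ℝ} {p : ℝ} (hp0 : 0 < p) (α : ℝ) :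
    normAp n f p α = ∫⁻ w, ‖f (pt w.1 w.2)‖ₑ ^ p * ENNReal.ofReal (w.2 ^ α) ∂(baseM n) := by
  unfold normAp mLam
  rw [lintegral_withDensity_eq_lintegral_mul_non_measurable _ (by fun_prop)
    (Eventually.of_forall fun _ => ENNReal.ofReal_lt_top)]
  refine lintegral_congr fun w => ?_
  rw [Pi.mul_apply, mul_comm, ← ENNReal.ofReal_rpow_of_nonneg (abs_nonneg _) hp0.le,
    Real.enorm_eq_ofReal_abs]

/-- The integral of the weight in its first variable. -/
lemma exists_lintegral_kerWeight_le (n m : ℕ) {p α : ℝ} (hα : -1 < α)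
    (hm : (n : ℝ) + 1 + α < p * ((m : ℝ) + n + 1)) :
    ∃ K : ℝ≥0∞, K ≠ ∞ ∧ ∀ w : Euc n × ℝ, 0 < w.2 →
      ∫⁻ z, ENNReal.ofReal (kerWeight n m p z w) * ENNReal.ofReal (z.2 ^ α) ∂(baseM n) ≤
        K * ENNReal.ofReal (w.2 ^ α) := by
  obtain ⟨K, hK, h⟩ := exists_lintegral_dist_rpow_le n hα hm
  refine ⟨K, hK, fun w hw => ?_⟩
  have hk : ∀ z : Euc n × ℝ, 0 < z.2 → kerWeight n m p z w =
      w.2 ^ (m * p + (n + 1) * (p - 1)) *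
        (‖z.1 - w.1‖ ^ 2 + (z.2 + w.2) ^ 2) ^ (-(p * ((m : ℝ) + n + 1)) / 2) := by
    intro z hz
    unfold kerWeight kerSize
    rw [Real.mul_rpow (by positivity) (by positivity), ← Real.rpow_mul hw.le,
      ← Real.rpow_mul (by positivity), ← Real.rpow_natCast w.2 (n + 1), ← Real.rpow_mul hw.le,
      Real.rpow_add hw]
    push_cast
    rw [show -((n : ℝ) + m + 1) / 2 * p = -(p * ((m : ℝ) + n + 1)) / 2 by ring]
    ring
  calc _ = ∫⁻ z, ENNReal.ofReal (w.2 ^ (m * p + (n + 1) * (p - 1))) *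
        (ENNReal.ofReal ((‖z.1 - w.1‖ ^ 2 + (z.2 + w.2) ^ 2) ^ (-(p * ((m : ℝ) + n + 1)) / 2)) *
          ENNReal.ofReal (z.2 ^ α)) ∂(baseM n) := by
        refine lintegral_congr_ae ?_
        filter_upwards [ae_baseM_pos n] with z hz
        rw [hk z hz, ENNReal.ofReal_mul (by positivity), mul_assoc]
    _ ≤ ENNReal.ofReal (w.2 ^ (m * p + (n + 1) * (p - 1))) *
        (K * ENNReal.ofReal (w.2 ^ ((n : ℝ) + 1 + α - p * ((m : ℝ) + n + 1)))) := by
        rw [lintegral_const_mul' _ _ ENNReal.ofReal_ne_top]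
        gcongr
        exact h w.1 w.2 hw
    _ = K * ENNReal.ofReal (w.2 ^ α) := by
        rw [mul_left_comm, ← ENNReal.ofReal_mul (by positivity), ← Real.rpow_add hw]
        congr 3
        ring

/-- the integral kernel estimate for f ∈ A^p_α, 0 < p ≤ 1. -/
theorem stmt16 (n : ℕ) (hn : 1 ≤ n) (p : ℝ) (hp0 : 0 < p) (hp1 : p ≤ 1)
    (α : ℝ) (hα : -1 < α) (m : ℕ)
    (hm : p * ((m : ℝ) + (n : ℝ) + 1) > (n : ℝ) + 1 + α) :
    ∃ C : ℝ, 0 < C ∧ ∀ f : Euc (n + 1) → ℝ, memAp n f p α →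
      (∫⁻ z : Euc n × ℝ,
          (∫⁻ w : Euc n × ℝ,
            ENNReal.ofReal (|f (pt w.1 w.2)| * |Qker n m z.1 z.2 w.1 w.2| * w.2 ^ (m : ℝ))
            ∂(baseM n)) ^ p * ENNReal.ofReal (z.2 ^ α)
          ∂(baseM n)) ≤
        ENNReal.ofReal C * normAp n f p α := by
  obtain ⟨C₀, hC₀, hQ⟩ := exists_abs_Qker_le n m
  obtain ⟨K₁, hK₁, h₁⟩ := exists_lintegral_kerSize_rpow_le n m hp0 hp1
  obtain ⟨K₂, hK₂, h₂⟩ := exists_lintegral_kerWeight_le n m (p := p) hα hm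
  set T : ℝ≥0∞ := ENNReal.ofReal C₀ ^ p * K₁ * K₂ with hT
  have hC₀p : ENNReal.ofReal C₀ ^ p ≠ ∞ :=
    ENNReal.rpow_ne_top_of_nonneg hp0.le ENNReal.ofReal_ne_top
  have hTt : T ≠ ∞ := by finiteness
  refine ⟨T.toReal + 1, by positivity, fun f hf => ?_⟩
  have hfm := aemeasurable_enorm_comp_pt hf.1.1.continuousOn
  have h_inner : ∀ z : Euc n × ℝ, 0 < z.2 →
      (∫⁻ w : Euc n × ℝ,
        ENNReal.ofReal (|f (pt w.1 w.2)| * |Qker n m z.1 z.2 w.1 w.2| * w.2 ^ (m : ℝ))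
        ∂(baseM n)) ^ p ≤ ENNReal.ofReal C₀ ^ p * K₁ *
          ∫⁻ w, ‖f (pt w.1 w.2)‖ₑ ^ p * ENNReal.ofReal (kerWeight n m p z w) ∂(baseM n) := by
    intro z hz
    calc _ ≤ (∫⁻ w, ENNReal.ofReal C₀ *
          (‖f (pt w.1 w.2)‖ₑ * ENNReal.ofReal (kerSize n m z w)) ∂(baseM n)) ^ p := by
          refine ENNReal.rpow_le_rpow (lintegral_mono_ae ?_) hp0.le
          filter_upwards [ae_baseM_pos n] with w hw
          rw [Real.enorm_eq_ofReal_abs, ← ENNReal.ofReal_mul (abs_nonneg _),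
            ← ENNReal.ofReal_mul hC₀]
          refine ENNReal.ofReal_le_ofReal ?_
          unfold kerSize
          calc |f (pt w.1 w.2)| * |Qker n m z.1 z.2 w.1 w.2| * w.2 ^ (m : ℝ)
              ≤ |f (pt w.1 w.2)| * (C₀ * (‖z.1 - w.1‖ ^ 2 + (z.2 + w.2) ^ 2) ^
                  (-((n : ℝ) + m + 1) / 2)) * w.2 ^ (m : ℝ) := by
                gcongr
                exact hQ z.1 w.1 z.2 w.2 hz hw
            _ = _ := by ring
      _ ≤ _ := by
          rw [lintegral_const_mul' _ _ ENNReal.ofReal_ne_top, ENNReal.mul_rpow_of_nonneg _ _ hp0.le,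
            mul_assoc]
          gcongr
          exact h₁ f hf.1 z hz
  have hmeas : AEMeasurable (Function.uncurry fun z w : Euc n × ℝ =>
      ‖f (pt w.1 w.2)‖ₑ ^ p * ENNReal.ofReal (kerWeight n m p z w) * ENNReal.ofReal (z.2 ^ α))
      ((baseM n).prod (baseM n)) := by
    have h1 : AEMeasurable (fun zw : (Euc n × ℝ) × (Euc n × ℝ) => ‖f (pt zw.2.1 zw.2.2)‖ₑ)
      ((baseM n).prod (baseM n)) := hfm.comp_snd
    exact ((h1.pow_const p).mul (measurable_kerWeight n m p).ennreal_ofReal.aemeasurable).mul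
      (by fun_prop)
  have hC₀K : ENNReal.ofReal C₀ ^ p * K₁ ≠ ∞ := by finiteness
  calc _ ≤ ∫⁻ z, ENNReal.ofReal C₀ ^ p * K₁ * (∫⁻ w, ‖f (pt w.1 w.2)‖ₑ ^ p *
          ENNReal.ofReal (kerWeight n m p z w) * ENNReal.ofReal (z.2 ^ α) ∂(baseM n))
          ∂(baseM n) := by
        refine lintegral_mono_ae ?_
        filter_upwards [ae_baseM_pos n] with z hz
        rw [lintegral_mul_const' _ _ ENNReal.ofReal_ne_top, ← mul_assoc]
        gcongr
        exact h_inner z hz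
    _ = ENNReal.ofReal C₀ ^ p * K₁ * ∫⁻ w, ‖f (pt w.1 w.2)‖ₑ ^ p * (∫⁻ z,
          ENNReal.ofReal (kerWeight n m p z w) * ENNReal.ofReal (z.2 ^ α) ∂(baseM n))
          ∂(baseM n) := by
        rw [lintegral_const_mul' _ _ hC₀K, lintegral_lintegral_swap hmeas]
        congr 2
        funext w
        rw [← lintegral_const_mul' _ _ (ENNReal.rpow_ne_top_of_nonneg hp0.le enorm_ne_top)]
        simp_rw [mul_assoc]
    _ ≤ ENNReal.ofReal C₀ ^ p * K₁ * ∫⁻ w, K₂ * (‖f (pt w.1 w.2)‖ₑ ^ p *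
          ENNReal.ofReal (w.2 ^ α)) ∂(baseM n) := by
        gcongr ENNReal.ofReal C₀ ^ p * K₁ * ?_
        refine lintegral_mono_ae ?_
        filter_upwards [ae_baseM_pos n] with w hw
        rw [mul_left_comm]
        gcongr
        exact h₂ w hw
    _ = T * normAp n f p α := by
        rw [lintegral_const_mul' _ _ hK₂, normAp_eq_lintegral_baseM n hp0, ← mul_assoc]
    _ ≤ ENNReal.ofReal (T.toReal + 1) * normAp n f p α := by
        gcongr
        rw [← ENNReal.ofReal_toReal hTt]
        exact ENNReal.ofReal_le_ofReal (by rw [ENNReal.ofReal_toReal hTt]; linarith)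

end
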